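/- arXiv:2107.06453 — 3 statements merged into one kernel-verified Lean document; each statement's English description precedes it below -/
import Mathlib

section
/- Let 0 ≤ t₀ < t₁ and let F, G, K : [t₀,t₁] → [0,∞) be continuous functions, with F differentiable on [t₀,t₁], satisfying F'(τ) + G(τ) ≤ K(τ)·F(τ) for all τ ∈ [t₀,t₁]. If ∫_{t₀}^{t₁} K(τ) dτ ≤ 1, then (t₁ − t₀)·F(t₁) + ∫_{t₀}^{t₁} (τ − t₀)·G(τ) dτ ≤ e · ∫_{t₀}^{t₁} F(τ) dτ. -/
open MeasureTheory intervalIntegral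

/-- The primitive of a function continuous on `[a, b]` is differentiable on `(a, b)`. -/
theorem ContinuousOn.hasDerivAt_integral_of_mem_Ioo {f : ℝ → ℝ} {a b t : ℝ}
    (hf : ContinuousOn f (Set.Icc a b)) (ht : t ∈ Set.Ioo a b) :
    HasDerivAt (fun u => ∫ τ in a..u, f τ) (f t) t := by
  refine integral_hasDerivAt_right ?_ ?_ ?_
  · refine ContinuousOn.intervalIntegrable ?_
    rw [Set.uIcc_of_le ht.1.le]
    exact hf.mono (Set.Icc_subset_Icc_right ht.2.le)
  · exact (hf.mono Set.Ioo_subset_Icc_self).stronglyMeasurableAtFilter isOpen_Ioo t ht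
  · exact hf.continuousAt (Icc_mem_nhds ht.1 ht.2)

/-- The primitive of a function continuous on `[a, b]` is continuous on `[a, b]`. -/
theorem ContinuousOn.continuousOn_integral_Icc {f : ℝ → ℝ} {a b : ℝ} (hab : a ≤ b)
    (hf : ContinuousOn f (Set.Icc a b)) :
    ContinuousOn (fun u => ∫ τ in a..u, f τ) (Set.Icc a b) := by
  rw [← Set.uIcc_of_le hab] at hf ⊢
  exact continuousOn_primitive_interval' hf.intervalIntegrable Set.left_mem_uIcc

/-- Time-weighted Gronwall-type lemma: if `F' + G ≤ K F` on `[t₀,t₁]` with `F, G, K`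
continuous and nonnegative, `F` differentiable, and `∫_{t₀}^{t₁} K ≤ 1`, then
`(t₁ − t₀) F(t₁) + ∫_{t₀}^{t₁} (τ − t₀) G(τ) dτ ≤ e ∫_{t₀}^{t₁} F(τ) dτ`. -/
theorem weighted_gronwall (t₀ t₁ : ℝ) (ht₀ : 0 ≤ t₀) (ht : t₀ < t₁)
    (F F' G K : ℝ → ℝ)
    (hF : ∀ τ ∈ Set.Icc t₀ t₁, HasDerivAt F (F' τ) τ)
    (hGc : ContinuousOn G (Set.Icc t₀ t₁))
    (hKc : ContinuousOn K (Set.Icc t₀ t₁))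
    (hFnn : ∀ τ ∈ Set.Icc t₀ t₁, 0 ≤ F τ)
    (hGnn : ∀ τ ∈ Set.Icc t₀ t₁, 0 ≤ G τ)
    (hKnn : ∀ τ ∈ Set.Icc t₀ t₁, 0 ≤ K τ)
    (hineq : ∀ τ ∈ Set.Icc t₀ t₁, F' τ + G τ ≤ K τ * F τ)
    (hKint : (∫ τ in t₀..t₁, K τ) ≤ 1) :
    (t₁ - t₀) * F t₁ + (∫ τ in t₀..t₁, (τ - t₀) * G τ)
      ≤ Real.exp 1 * ∫ τ in t₀..t₁, F τ := by
  have hle := ht.le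
  have hFc : ContinuousOn F (Set.Icc t₀ t₁) := fun τ hτ =>
    (hF τ hτ).continuousAt.continuousWithinAt
  have hwGc : ContinuousOn (fun τ => (τ - t₀) * G τ) (Set.Icc t₀ t₁) :=
    (continuousOn_id.sub continuousOn_const).mul hGc
  set A : ℝ → ℝ := fun u => ∫ τ in t₀..u, K τ
  have hAc : ContinuousOn A (Set.Icc t₀ t₁) := hKc.continuousOn_integral_Icc hle
  have hAd : ∀ t ∈ Set.Ioo t₀ t₁, HasDerivAt A (K t) t := fun t h =>
    hKc.hasDerivAt_integral_of_mem_Ioo h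
  have hA0 : A t₀ = 0 := integral_same
  have hA_mono : MonotoneOn A (Set.Icc t₀ t₁) := by
    refine monotoneOn_of_hasDerivWithinAt_nonneg (f' := K) (convex_Icc _ _) hAc ?_ ?_
    · intro x hx
      rw [interior_Icc] at hx
      exact (hAd x hx).hasDerivWithinAt
    · intro x hx
      exact hKnn x (interior_subset hx)
  have hl : t₀ ∈ Set.Icc t₀ t₁ := Set.left_mem_Icc.2 hle
  have hr : t₁ ∈ Set.Icc t₀ t₁ := Set.right_mem_Icc.2 hle
  have hA_nonneg : ∀ t ∈ Set.Icc t₀ t₁, 0 ≤ A t := fun t h =>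
    hA0 ▸ hA_mono hl h h.1
  have hA_le : ∀ t ∈ Set.Icc t₀ t₁, A t ≤ 1 := fun t h =>
    (hA_mono h hr h.2).trans hKint
  have hm_ge : ∀ t ∈ Set.Icc t₀ t₁, 1 ≤ Real.exp (1 - A t) := fun t h =>
    Real.one_le_exp (sub_nonneg.2 (hA_le t h))
  have hm_le : ∀ t ∈ Set.Icc t₀ t₁, Real.exp (1 - A t) ≤ Real.exp 1 := fun t h =>
    Real.exp_le_exp.2 (sub_le_self 1 (hA_nonneg t h))
  set H : ℝ → ℝ := fun u => (u - t₀) * F u * Real.exp (1 - A u)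
    + (∫ τ in t₀..u, (τ - t₀) * G τ) - Real.exp 1 * ∫ τ in t₀..u, F τ with hH
  have hH_anti : AntitoneOn H (Set.Icc t₀ t₁) := by
    refine antitoneOn_of_hasDerivWithinAt_nonpos
      (f' := fun t => (1 * F t + (t - t₀) * F' t) * Real.exp (1 - A t)
        + (t - t₀) * F t * (Real.exp (1 - A t) * (-K t))
        + (t - t₀) * G t - Real.exp 1 * F t) (convex_Icc _ _) ?_ ?_ ?_
    · exact ((((continuousOn_id.sub continuousOn_const).mul hFc).mul
        (continuousOn_const.sub hAc).rexp).add (hwGc.continuousOn_integral_Icc hle)).sub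
        (continuousOn_const.mul (hFc.continuousOn_integral_Icc hle))
    · intro t h
      rw [interior_Icc] at h
      exact ((((((hasDerivAt_id t).sub_const t₀).mul (hF t (Set.Ioo_subset_Icc_self h))).mul
        ((hAd t h).const_sub 1).exp).add (hwGc.hasDerivAt_integral_of_mem_Ioo h)).sub
        ((hFc.hasDerivAt_integral_of_mem_Ioo h).const_mul _)).hasDerivWithinAt
    · intro t h
      have h := interior_subset h
      have hs : 0 ≤ t - t₀ := sub_nonneg.2 h.1
      have h1 := mul_nonneg (mul_nonneg hs (Real.exp_pos (1 - A t)).le)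
        (sub_nonneg.2 (hineq t h))
      have h2 := mul_nonneg (sub_nonneg.2 (hm_le t h)) (hFnn t h)
      have h3 := mul_nonneg (mul_nonneg hs (hGnn t h)) (sub_nonneg.2 (hm_ge t h))
      linarith
  have hH0 : H t₀ = 0 := by simp [hH]
  have hH1 : H t₁ ≤ 0 := hH0 ▸ hH_anti hl hr hle
  have hF1 := le_mul_of_one_le_right
    (mul_nonneg (sub_nonneg.2 hle) (hFnn t₁ hr)) (hm_ge t₁ hr)
  simp only [hH] at hH1
  linarith
end

section
/- Let s ∈ (0,1) and let δ satisfy max(0, s − 1/4) < δ < 3/4. Then there exists a constant C > 0 such that for all t > 0: ∫₀^t (t−τ)^{−δ} · (1+τ)^{−s} · τ^{−(3/4−δ)} dτ ≤ C · (1+t)^{−s} · t^{1/4}. -/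
open MeasureTheory

/-- The real Beta kernel is integrable on the unit interval. -/
theorem integrableOn_rpow_mul_one_sub_rpow {u v : ℝ} (hu : 0 < u) (hv : 0 < v) :
    IntegrableOn (fun x : ℝ => x ^ (u - 1) * (1 - x) ^ (v - 1)) (Set.Ioo 0 1) := by
  have h := Complex.betaIntegral_convergent (u := (u : ℂ)) (v := (v : ℂ))
    (by simpa using hu) (by simpa using hv)
  rw [intervalIntegrable_iff_integrableOn_Ioo_of_le zero_le_one] at h
  refine IntegrableOn.congr_fun h.norm (fun x hx => ?_) measurableSet_Ioo
  have h1 : (0 : ℝ) < 1 - x := sub_pos.2 hx.2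
  have h2 : (1 : ℂ) - x = ((1 - x : ℝ) : ℂ) := by push_cast; rfl
  simp only [norm_mul]
  rw [h2, Complex.norm_cpow_eq_rpow_re_of_pos hx.1, Complex.norm_cpow_eq_rpow_re_of_pos h1]
  simp

/-- Rescaling an integral over `(0, t)` to the unit interval. -/
theorem setIntegral_Ioo_zero_eq_mul (f : ℝ → ℝ) {t : ℝ} (ht : 0 < t) :
    ∫ τ in Set.Ioo (0 : ℝ) t, f τ = t * ∫ x in Set.Ioo (0 : ℝ) 1, f (t * x) := by
  rw [← integral_Ioc_eq_integral_Ioo, ← integral_Ioc_eq_integral_Ioo,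
    ← intervalIntegral.integral_of_le ht.le, ← intervalIntegral.integral_of_le zero_le_one]
  rw [intervalIntegral.mul_integral_comp_mul_left, mul_zero, mul_one]

/-- The weight `(1 + t x) ^ (-s)` is dominated by `(1 + t) ^ (-s) * x ^ (-s)` on `(0, 1]`. -/
theorem one_add_mul_rpow_neg_le {s t x : ℝ} (hs : 0 ≤ s) (ht : 0 < t) (hx : 0 < x)
    (hx1 : x ≤ 1) : (1 + t * x) ^ (-s) ≤ (1 + t) ^ (-s) * x ^ (-s) := by
  rw [← Real.mul_rpow (by positivity) hx.le]
  exact Real.rpow_le_rpow_of_nonpos (by positivity) (by nlinarith) (by linarith)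

/-- Convolution-in-time estimate: for `s ∈ (0,1)` and `max(0, s − 1/4) < δ < 3/4`,
`∫₀^t (t−τ)^{−δ} (1+τ)^{−s} τ^{−(3/4−δ)} dτ ≤ C (1+t)^{−s} t^{1/4}` for all `t > 0`. -/
theorem convolution_time_estimate (s δ : ℝ) (hs : s ∈ Set.Ioo (0 : ℝ) 1)
    (hδ₁ : max 0 (s - 1 / 4) < δ) (hδ₂ : δ < 3 / 4) :
    ∃ C : ℝ, 0 < C ∧ ∀ t : ℝ, 0 < t →
      (∫ τ in Set.Ioo (0 : ℝ) t,
          (t - τ) ^ (-δ) * (1 + τ) ^ (-s) * τ ^ (-(3 / 4 - δ)))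
        ≤ C * (1 + t) ^ (-s) * t ^ ((1 : ℝ) / 4) := by
  have hδs : s - 1 / 4 < δ := (le_max_right _ _).trans_lt hδ₁
  set g : ℝ → ℝ := fun x => x ^ ((1 / 4 + δ - s) - 1) * (1 - x) ^ ((1 - δ) - 1) with hg
  have hgi : IntegrableOn g (Set.Ioo 0 1) :=
    integrableOn_rpow_mul_one_sub_rpow (by linarith) (by linarith)
  have hg0 : 0 ≤ ∫ x in Set.Ioo (0 : ℝ) 1, g x :=
    setIntegral_nonneg measurableSet_Ioo fun x hx =>
      mul_nonneg (Real.rpow_nonneg hx.1.le _) (Real.rpow_nonneg (sub_nonneg.2 hx.2.le) _)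
  refine ⟨(∫ x in Set.Ioo (0 : ℝ) 1, g x) + 1, by linarith, fun t ht => ?_⟩
  rw [setIntegral_Ioo_zero_eq_mul _ ht]
  have hbound : ∫ x in Set.Ioo (0 : ℝ) 1,
      (t - t * x) ^ (-δ) * (1 + t * x) ^ (-s) * (t * x) ^ (-(3 / 4 - δ)) ≤
      ∫ x in Set.Ioo (0 : ℝ) 1, t ^ (-(3 / 4) : ℝ) * (1 + t) ^ (-s) * g x := by
    refine integral_mono_of_nonneg ?_ (hgi.const_mul _) ?_
    · filter_upwards [ae_restrict_mem measurableSet_Ioo] with x hx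
      have hx0 := hx.1
      have h1 : 0 ≤ t - t * x := by nlinarith [hx.2]
      simp only [Pi.zero_apply]
      positivity
    · filter_upwards [ae_restrict_mem measurableSet_Ioo] with x hx
      have hx0 := hx.1
      have h1 : 0 < 1 - x := sub_pos.2 hx.2
      have ht' : t ^ (-(3 / 4) : ℝ) = t ^ (-δ) * t ^ (-(3 / 4 - δ)) := by
        rw [← Real.rpow_add ht]; ring_nf
      have hx' : x ^ ((1 / 4 + δ - s) - 1) = x ^ (-s) * x ^ (-(3 / 4 - δ)) := by
        rw [← Real.rpow_add hx0]; ring_nf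
      have hδ' : (1 - δ) - 1 = -δ := by ring
      calc (t - t * x) ^ (-δ) * (1 + t * x) ^ (-s) * (t * x) ^ (-(3 / 4 - δ))
          ≤ (t * (1 - x)) ^ (-δ) * ((1 + t) ^ (-s) * x ^ (-s)) * (t * x) ^ (-(3 / 4 - δ)) := by
            rw [show t - t * x = t * (1 - x) by ring]
            gcongr
            exact one_add_mul_rpow_neg_le hs.1.le ht hx0 hx.2.le
        _ = t ^ (-(3 / 4) : ℝ) * (1 + t) ^ (-s) * g x := by
            rw [hg, Real.mul_rpow ht.le h1.le, Real.mul_rpow ht.le hx0.le]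
            simp only [ht', hx', hδ']
            ring
  rw [integral_const_mul] at hbound
  have htt : t * t ^ (-(3 / 4) : ℝ) = t ^ ((1 : ℝ) / 4) := by
    rw [← Real.rpow_one_add' ht.le (by norm_num)]; norm_num
  calc _ ≤ t * (t ^ (-(3 / 4) : ℝ) * (1 + t) ^ (-s) * ∫ x in Set.Ioo (0 : ℝ) 1, g x) :=
        mul_le_mul_of_nonneg_left hbound ht.le
    _ = (∫ x in Set.Ioo (0 : ℝ) 1, g x) * (1 + t) ^ (-s) * t ^ ((1 : ℝ) / 4) := by
        rw [← htt]; ring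
    _ ≤ _ := by gcongr; linarith
end

section
/- Let s ∈ (0,1). There exists a constant C = C(s) > 0 such that for every t > 0 and every measurable w = (w₁,w₂,w₃) : ℝ³ → ℂ³ satisfying the divergence-free condition ξ₁w₁(ξ) + ξ₂w₂(ξ) + ξ₃w₃(ξ) = 0 for almost every ξ ∈ ℝ³, one has ∫_{{ξ ∈ ℝ³ : |ξ_h| ≤ |ξ₃|}} e^{−2t|ξ_h|²} |w₃(ξ)|² dξ ≤ C · t^{−(3s/2 + 1/4)} · ∫_{ℝ³} |ξ_h|^{−2s} |ξ₃|^{−(s+1/2)} (|w₁(ξ)|² + |w₂(ξ)|²) dξ. -/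
open MeasureTheory
open scoped ENNReal

noncomputable section

/-- `|ξ_h| = (ξ₁² + ξ₂²)^{1/2}`, the magnitude of the horizontal frequencies. -/
def hmag (ξ : EuclideanSpace ℝ (Fin 3)) : ℝ := Real.sqrt (ξ 0 ^ 2 + ξ 1 ^ 2)

lemma continuous_hmag : Continuous hmag := by
  unfold hmag
  fun_prop

/-- The gain from the heat factor: `e^{-2x} ≤ x^{-p}` for `x > 0` and `0 ≤ p ≤ 2`. -/
lemma exp_neg_two_mul_le_rpow_neg {x p : ℝ} (hx : 0 < x) (hp : 0 ≤ p) (hp2 : p ≤ 2) :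
    Real.exp (-(2 * x)) ≤ x ^ (-p) := by
  rw [Real.exp_neg, Real.rpow_neg hx.le]
  apply inv_anti₀ (by positivity)
  calc x ^ p ≤ Real.exp x ^ p :=
        Real.rpow_le_rpow hx.le (by linarith [Real.add_one_le_exp x]) hp
    _ = Real.exp (x * p) := (Real.exp_mul x p).symm
    _ ≤ Real.exp (2 * x) := Real.exp_le_exp.mpr (by nlinarith)

/-- Pointwise form of the multiplier estimate, with `a = |ξ_h|` and `b = |ξ₃|`. -/
lemma exp_neg_mul_sq_div_sq_le {s t a b : ℝ} (hs : s ∈ Set.Ioo (0 : ℝ) 1) (ht : 0 < t)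
    (ha : 0 < a) (hab : a ≤ b) :
    Real.exp (-(2 * t * a ^ 2)) * (a ^ 2 / b ^ 2)
      ≤ t ^ (-(3 * s / 2 + 1 / 4)) * (a ^ (-(2 * s)) * b ^ (-(s + 1 / 2))) := by
  obtain ⟨hs0, hs1⟩ := hs
  have hb : 0 < b := ha.trans_le hab
  have hexp : Real.exp (-(2 * t * a ^ 2))
      ≤ t ^ (-(3 * s / 2 + 1 / 4)) * a ^ (-(3 * s + 1 / 2)) := by
    have h := exp_neg_two_mul_le_rpow_neg (x := t * a ^ 2) (p := 3 * s / 2 + 1 / 4)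
      (by positivity) (by linarith) (by linarith)
    rw [Real.mul_rpow ht.le (by positivity), ← Real.rpow_natCast a 2, ← Real.rpow_mul ha.le,
      Real.rpow_natCast, ← mul_assoc] at h
    convert h using 3
    push_cast
    ring
  have hsplit : a ^ (-(3 * s + 1 / 2)) * a ^ 2 = a ^ (-(2 * s)) * a ^ (3 / 2 - s) := by
    rw [← Real.rpow_natCast a 2, ← Real.rpow_add ha, ← Real.rpow_add ha]
    congr 1
    push_cast
    ring
  have hvert : b ^ (3 / 2 - s) / b ^ 2 = b ^ (-(s + 1 / 2)) := by
    rw [← Real.rpow_natCast b 2, ← Real.rpow_sub hb]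
    congr 1
    push_cast
    ring
  calc Real.exp (-(2 * t * a ^ 2)) * (a ^ 2 / b ^ 2)
      ≤ t ^ (-(3 * s / 2 + 1 / 4)) * a ^ (-(3 * s + 1 / 2)) * (a ^ 2 / b ^ 2) := by gcongr
    _ = t ^ (-(3 * s / 2 + 1 / 4)) * (a ^ (-(2 * s)) * (a ^ (3 / 2 - s) / b ^ 2)) := by
        rw [mul_assoc, ← mul_div_assoc, hsplit, mul_div_assoc (a ^ (-(2 * s)))]
    _ ≤ t ^ (-(3 * s / 2 + 1 / 4)) * (a ^ (-(2 * s)) * (b ^ (3 / 2 - s) / b ^ 2)) := by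
        gcongr
        linarith
    _ = _ := by rw [hvert]

/-- Cauchy–Schwarz applied to the divergence-free relation. -/
lemma sq_mul_norm_sq_le_of_divergence_free {x y z : ℝ} {u v w : ℂ}
    (h : (x : ℂ) * u + (y : ℂ) * v + (z : ℂ) * w = 0) :
    z ^ 2 * ‖w‖ ^ 2 ≤ (x ^ 2 + y ^ 2) * (‖u‖ ^ 2 + ‖v‖ ^ 2) := by
  have hz : (z : ℂ) * w = -((x : ℂ) * u + (y : ℂ) * v) := by linear_combination h
  have hn : |z| * ‖w‖ ≤ |x| * ‖u‖ + |y| * ‖v‖ := by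
    calc |z| * ‖w‖ = ‖(z : ℂ) * w‖ := by simp
      _ = ‖(x : ℂ) * u + (y : ℂ) * v‖ := by rw [hz, norm_neg]
      _ ≤ ‖(x : ℂ) * u‖ + ‖(y : ℂ) * v‖ := norm_add_le _ _
      _ = _ := by simp
  calc z ^ 2 * ‖w‖ ^ 2 = (|z| * ‖w‖) ^ 2 := by rw [mul_pow, sq_abs]
    _ ≤ (|x| * ‖u‖ + |y| * ‖v‖) ^ 2 := by gcongr
    _ ≤ (|x| ^ 2 + |y| ^ 2) * (‖u‖ ^ 2 + ‖v‖ ^ 2) := by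
        nlinarith [sq_nonneg (|x| * ‖v‖ - |y| * ‖u‖)]
    _ = _ := by rw [sq_abs, sq_abs]

/-- Low-horizontal-frequency estimate (the term `A₁`): for `s ∈ (0,1)` there is `C > 0`
such that for every `t > 0` and every measurable `w : ℝ³ → ℂ³` with
`ξ₁w₁(ξ) + ξ₂w₂(ξ) + ξ₃w₃(ξ) = 0` a.e. (Fourier-side divergence-free condition),
`∫_{|ξ_h| ≤ |ξ₃|} e^{−2t|ξ_h|²} |w₃|² ≤ C t^{−(3s/2+1/4)}
  ∫ |ξ_h|^{−2s} |ξ₃|^{−(s+1/2)} (|w₁|² + |w₂|²)`. -/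
theorem low_frequency_enhanced_decay (s : ℝ) (hs : s ∈ Set.Ioo (0 : ℝ) 1) :
    ∃ C : ℝ, 0 < C ∧ ∀ t : ℝ, 0 < t →
      ∀ w : EuclideanSpace ℝ (Fin 3) → Fin 3 → ℂ, Measurable w →
        (∀ᵐ ξ : EuclideanSpace ℝ (Fin 3),
          (ξ 0 : ℂ) * w ξ 0 + (ξ 1 : ℂ) * w ξ 1 + (ξ 2 : ℂ) * w ξ 2 = 0) →
        (∫⁻ ξ in {ξ : EuclideanSpace ℝ (Fin 3) | hmag ξ ≤ |ξ 2|},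
            ENNReal.ofReal (Real.exp (-(2 * t * hmag ξ ^ 2))) * ENNReal.ofReal (‖w ξ 2‖ ^ 2))
          ≤ ENNReal.ofReal (C * t ^ (-(3 * s / 2 + 1 / 4)))
            * ∫⁻ ξ : EuclideanSpace ℝ (Fin 3),
                ENNReal.ofReal (hmag ξ ^ (-(2 * s)) * |ξ 2| ^ (-(s + 1 / 2))
                  * (‖w ξ 0‖ ^ 2 + ‖w ξ 1‖ ^ 2)) := by
  refine ⟨1, one_pos, fun t ht w _ hdiv => ?_⟩
  rw [one_mul, ← lintegral_const_mul' _ _ ENNReal.ofReal_ne_top]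
  refine le_trans (lintegral_mono_ae ?_) (setLIntegral_le_lintegral _ _)
  rw [ae_restrict_iff' (measurableSet_le continuous_hmag.measurable (by fun_prop))]
  filter_upwards [hdiv, Measure.ae_ne volume 0] with ξ hξ hξ0 hmem
  rw [← ENNReal.ofReal_mul (Real.exp_pos _).le, ← ENNReal.ofReal_mul (by positivity)]
  apply ENNReal.ofReal_le_ofReal
  have hsq : hmag ξ ^ 2 = ξ 0 ^ 2 + ξ 1 ^ 2 := Real.sq_sqrt (by positivity)
  have ha : 0 ≤ hmag ξ := Real.sqrt_nonneg _
  have hb : 0 < |ξ 2| := by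
    rw [abs_pos]
    intro h2
    have h0 : hmag ξ = 0 := le_antisymm (by simpa [h2] using hmem) ha
    rw [h0] at hsq
    refine hξ0 (PiLp.ext fun i => ?_)
    fin_cases i
    · simp; nlinarith [sq_nonneg (ξ 0), sq_nonneg (ξ 1)]
    · simp; nlinarith [sq_nonneg (ξ 0), sq_nonneg (ξ 1)]
    · exact h2
  have hw := sq_mul_norm_sq_le_of_divergence_free hξ
  rw [← hsq, ← sq_abs (ξ 2)] at hw
  have hw' : ‖w ξ 2‖ ^ 2 ≤ hmag ξ ^ 2 / |ξ 2| ^ 2 * (‖w ξ 0‖ ^ 2 + ‖w ξ 1‖ ^ 2) := by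
    rw [div_mul_eq_mul_div, le_div_iff₀ (by positivity), mul_comm]
    exact hw
  calc _ ≤ Real.exp (-(2 * t * hmag ξ ^ 2)) * (hmag ξ ^ 2 / |ξ 2| ^ 2)
        * (‖w ξ 0‖ ^ 2 + ‖w ξ 1‖ ^ 2) := by
        rw [mul_assoc (Real.exp _)]
        gcongr
    _ ≤ t ^ (-(3 * s / 2 + 1 / 4)) * (hmag ξ ^ (-(2 * s)) * |ξ 2| ^ (-(s + 1 / 2)))
        * (‖w ξ 0‖ ^ 2 + ‖w ξ 1‖ ^ 2) := by
        rcases ha.eq_or_lt with h0 | hpos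
        · rw [← h0]
          simp only [ne_eq, OfNat.ofNat_ne_zero, not_false_eq_true, zero_pow, zero_div, mul_zero,
            zero_mul]
          positivity
        · gcongr ?_ * _
          exact exp_neg_mul_sq_div_sq_le hs ht hpos hmem
    _ = _ := by rw [mul_assoc]
end
end
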